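/- Let I be a countable index set, let ℓ : I → ℝ satisfy ℓ(i) ≥ ℓ₀ for all i, where ℓ₀ > 0, and suppose there are constants C₀ > 0 and δ ≥ 0 such that #{i ∈ I : ℓ(i) ≤ R} ≤ C₀·e^{δR} for every R > 0. Then for every real s > δ, the series ∑_{i∈I} e^{−s·ℓ(i)} converges and satisfies ∑_{i∈I} e^{−s·ℓ(i)} ≤ C₀·(s/(s−δ))·e^{−(s−δ)ℓ₀}. -/

import Mathlib

/-- Summation-by-counting estimate: if `#{i : ℓ i ≤ R} ≤ C₀ e^{δ R}` and `ℓ i ≥ ℓ₀ > 0`,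
then for `s > δ` the series `∑ e^{-s ℓ i}` converges with the stated bound. -/
theorem stmt_1 (I : Type*) [Countable I] (ℓ : I → ℝ) (ℓ₀ : ℝ) (hℓ₀ : 0 < ℓ₀)
    (hℓ : ∀ i, ℓ₀ ≤ ℓ i) (C₀ δ : ℝ) (hC₀ : 0 < C₀) (hδ : 0 ≤ δ)
    (hcount : ∀ R : ℝ, 0 < R → {i | ℓ i ≤ R}.Finite ∧
      (Nat.card {i | ℓ i ≤ R} : ℝ) ≤ C₀ * Real.exp (δ * R))
    (s : ℝ) (hs : δ < s) :
    Summable (fun i => Real.exp (-s * ℓ i)) ∧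
      ∑' i, Real.exp (-s * ℓ i) ≤ C₀ * (s / (s - δ)) * Real.exp (-(s - δ) * ℓ₀) := by
  have hs0 : 0 < s := lt_of_le_of_lt hδ hs
  have hsd : 0 < s - δ := sub_pos.2 hs
  have hint : ∀ c : ℝ, MeasureTheory.IntegrableOn (fun t => s * Real.exp (-s * t)) (Set.Ioi c) :=
    fun c => (integrableOn_exp_mul_Ioi (neg_lt_zero.2 hs0) c).const_mul s
  have hterm : ∀ i, ∫ t in Set.Ioi ℓ₀,
      (Set.Ioi (ℓ i)).indicator (fun t => s * Real.exp (-s * t)) t = Real.exp (-s * ℓ i) := by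
    intro i
    rw [MeasureTheory.setIntegral_indicator measurableSet_Ioi,
      Set.inter_eq_self_of_subset_right (Set.Ioi_subset_Ioi (hℓ i)),
      MeasureTheory.integral_const_mul, integral_exp_mul_Ioi (neg_lt_zero.2 hs0)]
    field_simp
  have key : ∀ F : Finset I, ∑ i ∈ F, Real.exp (-s * ℓ i)
      ≤ C₀ * (s / (s - δ)) * Real.exp (-(s - δ) * ℓ₀) := by
    intro F
    have hi : ∀ i ∈ F, MeasureTheory.IntegrableOn
        (fun t => (Set.Ioi (ℓ i)).indicator (fun t => s * Real.exp (-s * t)) t) (Set.Ioi ℓ₀) :=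
      fun i _ => (hint ℓ₀).indicator measurableSet_Ioi
    have hR : ∫ t in Set.Ioi ℓ₀, (C₀ * s) * Real.exp (-(s - δ) * t)
        = C₀ * (s / (s - δ)) * Real.exp (-(s - δ) * ℓ₀) := by
      rw [MeasureTheory.integral_const_mul, integral_exp_mul_Ioi (neg_lt_zero.2 hsd)]
      field_simp
    rw [← hR, ← Finset.sum_congr rfl (fun i _ => hterm i), ← MeasureTheory.integral_finsetSum F hi]
    refine MeasureTheory.setIntegral_mono_on (MeasureTheory.integrable_finsetSum F hi)
      ((integrableOn_exp_mul_Ioi (neg_lt_zero.2 hsd) ℓ₀).const_mul _) measurableSet_Ioi ?_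
    intro t ht
    obtain ⟨hfin, hc⟩ := hcount t (hℓ₀.trans ht)
    have hsum : ∑ i ∈ F, (Set.Ioi (ℓ i)).indicator (fun t => s * Real.exp (-s * t)) t
        ≤ (Nat.card {i | ℓ i ≤ t} : ℝ) * (s * Real.exp (-s * t)) := by
      classical
      simp only [Set.indicator_apply, Set.mem_Ioi]
      rw [← Finset.sum_filter, Finset.sum_const, nsmul_eq_mul]
      refine mul_le_mul_of_nonneg_right ?_ (by positivity)
      rw [Nat.card_coe_set_eq, Set.ncard_eq_toFinset_card _ hfin]
      norm_cast
      apply Finset.card_le_card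
      intro i h
      simp only [Finset.mem_filter] at h
      simpa using h.2.le
    refine hsum.trans ((mul_le_mul_of_nonneg_right hc (by positivity)).trans (le_of_eq ?_))
    rw [show -(s - δ) * t = δ * t + -s * t by ring, Real.exp_add]
    ring
  have hsm : Summable (fun i => Real.exp (-s * ℓ i)) :=
    summable_of_sum_le (fun i => (Real.exp_pos _).le) key
  exact ⟨hsm, hsm.tsum_le_of_sum_le key⟩
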